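/- arXiv:1905.04239 — 2 statements merged into one kernel-verified Lean document; each statement's English description precedes it below -/
import Mathlib

section
/- Let p ∈ [0,1], q = 1 − p, and let 0 < c < 1. Then lim_{n→∞} P_n^{(⌊cn⌋)} = 0 if p > q, lim_{n→∞} P_n^{(⌊cn⌋)} = 1 − c if p = q, and lim_{n→∞} P_n^{(⌊cn⌋)} = 1 if p < q (the limit being taken over n large enough that 1 ≤ ⌊cn⌋ < n). -/
open scoped Classical
open Filter Topology

/-- The step value of a classical walk move: `true` ↦ +1, `false` ↦ −1. -/
def cstep (x : Bool) : ℤ := if x then 1 else -1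

/-- Partial displacement `S_k(γ) = x_1 + ⋯ + x_k` of a `t`-path. -/
def cS {t : ℕ} (γ : Fin t → Bool) (k : ℕ) : ℤ :=
  ∑ i ∈ Finset.univ.filter (fun i : Fin t => (i : ℕ) < k), cstep (γ i)

/-- Probability weight `P(γ) = p^{(t+S)/2} q^{(t−S)/2}` of a `t`-path. -/
noncomputable def cwt (p : ℝ) {t : ℕ} (γ : Fin t → Bool) : ℝ :=
  ∏ i : Fin t, (if γ i then p else 1 - p)

/-- Semi-infinite left absorption probability `P_∞^{(m)}`. -/
noncomputable def PinfC (p : ℝ) (m : ℕ) : ℝ :=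
  ∑' t : ℕ, ∑ γ ∈ Finset.univ.filter
      (fun γ : Fin t → Bool => cS γ t = -(m : ℤ) ∧ ∀ k < t, -(m : ℤ) < cS γ k),
    cwt p γ

/-- Finite left absorption probability `P_n^{(m)}` (absorbing boundaries at `0` and `n`). -/
noncomputable def PfinC (p : ℝ) (n m : ℕ) : ℝ :=
  ∑' t : ℕ, ∑ γ ∈ Finset.univ.filter
      (fun γ : Fin t → Bool => cS γ t = -(m : ℤ) ∧ (∀ k < t, -(m : ℤ) < cS γ k) ∧
        ∀ k ≤ t, cS γ k < (n : ℤ) - (m : ℤ)),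
    cwt p γ

/-- Weight of the `t`-step paths from `m` that are absorbed at `0` at time `t`, staying below `n`. -/
noncomputable def absorbedAt (p : ℝ) (n m t : ℕ) : ℝ :=
  ∑ γ ∈ Finset.univ.filter
      (fun γ : Fin t → Bool => cS γ t = -(m : ℤ) ∧ (∀ k < t, -(m : ℤ) < cS γ k) ∧
        ∀ k ≤ t, cS γ k < (n : ℤ) - (m : ℤ)),
    cwt p γ

theorem cS_zero {t : ℕ} (γ : Fin t → Bool) : cS γ 0 = 0 := by
  simp [cS]

theorem cS_cons {t : ℕ} (x : Bool) (γ : Fin t → Bool) (k : ℕ) :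
    cS (Fin.cons x γ : Fin (t + 1) → Bool) (k + 1) = cstep x + cS γ k := by
  simp [cS, Finset.sum_filter, Fin.sum_univ_succ]

theorem cwt_cons (p : ℝ) {t : ℕ} (x : Bool) (γ : Fin t → Bool) :
    cwt p (Fin.cons x γ : Fin (t + 1) → Bool) = (if x then p else 1 - p) * cwt p γ := by
  simp [cwt, Fin.prod_univ_succ]

theorem cwt_nonneg {p : ℝ} (hp0 : 0 ≤ p) (hp1 : p ≤ 1) {t : ℕ} (γ : Fin t → Bool) :
    0 ≤ cwt p γ := by
  refine Finset.prod_nonneg fun i _ => ?_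
  split_ifs <;> linarith

theorem absorbedAt_nonneg {p : ℝ} (hp0 : 0 ≤ p) (hp1 : p ≤ 1) (n m t : ℕ) :
    0 ≤ absorbedAt p n m t :=
  Finset.sum_nonneg fun γ _ => cwt_nonneg hp0 hp1 γ

theorem absorbedAt_self (p : ℝ) (n t : ℕ) : absorbedAt p n n t = 0 := by
  unfold absorbedAt
  rw [Finset.filter_false_of_mem, Finset.sum_empty]
  rintro γ - ⟨-, -, h⟩
  simpa [cS_zero] using h 0 (Nat.zero_le t)

theorem absorbedAt_zero_zero (p : ℝ) {n : ℕ} (hn : 0 < n) : absorbedAt p n 0 0 = 1 := by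
  simp [absorbedAt, cS_zero, cwt, hn]

theorem absorbedAt_zero_succ (p : ℝ) (n t : ℕ) : absorbedAt p n 0 (t + 1) = 0 := by
  unfold absorbedAt
  rw [Finset.filter_false_of_mem, Finset.sum_empty]
  rintro γ - ⟨-, h, -⟩
  simpa [cS_zero] using h 0 (Nat.succ_pos t)

theorem absorbedAt_succ_zero (p : ℝ) (n j : ℕ) : absorbedAt p n (j + 1) 0 = 0 := by
  unfold absorbedAt
  rw [Finset.filter_false_of_mem, Finset.sum_empty]
  rintro γ - ⟨h, -, -⟩
  rw [cS_zero] at h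
  push_cast at h
  omega

theorem cons_absorbed_iff {n j m t : ℕ} (hj : j + 1 < n) (x : Bool)
    (hm : (m : ℤ) = j + 1 + cstep x) (γ : Fin t → Bool) :
    (cS (Fin.cons x γ : Fin (t + 1) → Bool) (t + 1) = -((j + 1 : ℕ) : ℤ) ∧
      (∀ k < t + 1, -((j + 1 : ℕ) : ℤ) < cS (Fin.cons x γ : Fin (t + 1) → Bool) k) ∧
      ∀ k ≤ t + 1, cS (Fin.cons x γ : Fin (t + 1) → Bool) k < (n : ℤ) - ((j + 1 : ℕ) : ℤ)) ↔
    (cS γ t = -(m : ℤ) ∧ (∀ k < t, -(m : ℤ) < cS γ k) ∧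
      ∀ k ≤ t, cS γ k < (n : ℤ) - (m : ℤ)) := by
  rw [cS_cons]
  push_cast
  refine and_congr (by omega) (and_congr ⟨fun h k hk => ?_, fun h k hk => ?_⟩
    ⟨fun h k hk => ?_, fun h k hk => ?_⟩)
  · have := h (k + 1) (by omega)
    rw [cS_cons] at this
    omega
  · rcases k with _ | k
    · rw [cS_zero]; omega
    · have := h k (by omega)
      rw [cS_cons]
      omega
  · have := h (k + 1) (by omega)
    rw [cS_cons] at this
    omega
  · rcases k with _ | k
    · rw [cS_zero]; omega
    · have := h k (by omega)
      rw [cS_cons]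
      omega

theorem absorbedAt_succ_succ (p : ℝ) {n j : ℕ} (hj : j + 1 < n) (t : ℕ) :
    absorbedAt p n (j + 1) (t + 1) =
      p * absorbedAt p n (j + 2) t + (1 - p) * absorbedAt p n j t := by
  simp only [absorbedAt, Finset.sum_filter]
  rw [← (Fin.consEquiv fun _ : Fin (t + 1) => Bool).sum_comp, Fintype.sum_prod_type,
    Fintype.sum_bool, Finset.mul_sum, Finset.mul_sum]
  congr 1 <;> refine Finset.sum_congr rfl fun γ _ => ?_
  · refine (if_congr (cons_absorbed_iff (m := j + 2) hj true (by simp [cstep]; ring) γ)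
      (cwt_cons p true γ) rfl).trans ?_
    simp
  · refine (if_congr (cons_absorbed_iff (m := j) hj false (by simp [cstep]) γ)
      (cwt_cons p false γ) rfl).trans ?_
    simp

theorem sum_absorbedAt_le {p : ℝ} (hp0 : 0 ≤ p) (hp1 : p ≤ 1) {n : ℕ} (hn : 0 < n) {h : ℕ → ℝ}
    (h_nonneg : ∀ m, 0 ≤ h m) (h_zero : 1 ≤ h 0)
    (h_super : ∀ j, p * h (j + 2) + (1 - p) * h j ≤ h (j + 1)) (T : ℕ) :
    ∀ m ≤ n, ∑ t ∈ Finset.range T, absorbedAt p n m t ≤ h m := by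
  induction T with
  | zero => simpa using fun m _ => h_nonneg m
  | succ T ih =>
    intro m hm
    rw [Finset.sum_range_succ']
    rcases m with _ | j
    · simpa [absorbedAt_zero_succ, absorbedAt_zero_zero p hn] using h_zero
    rcases hm.eq_or_lt with rfl | hj
    · simpa [absorbedAt_self] using h_nonneg (j + 1)
    · simp only [absorbedAt_succ_succ p hj, absorbedAt_succ_zero, Finset.sum_add_distrib,
        ← Finset.mul_sum, add_zero]
      refine le_trans (add_le_add (mul_le_mul_of_nonneg_left (ih _ hj) hp0)
        (mul_le_mul_of_nonneg_left (ih _ (by omega)) (by linarith))) (h_super j)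

theorem summable_absorbedAt {p : ℝ} (hp0 : 0 ≤ p) (hp1 : p ≤ 1) {n m : ℕ} (hn : 0 < n)
    (hm : m ≤ n) : Summable (absorbedAt p n m) :=
  summable_of_sum_range_le (absorbedAt_nonneg hp0 hp1 n m) fun T =>
    sum_absorbedAt_le (h := fun _ => 1) hp0 hp1 hn (by simp) (by simp) (by simp) T m hm

theorem PfinC_eq_tsum (p : ℝ) (n m : ℕ) : PfinC p n m = ∑' t, absorbedAt p n m t := rfl

theorem PfinC_nonneg {p : ℝ} (hp0 : 0 ≤ p) (hp1 : p ≤ 1) (n m : ℕ) : 0 ≤ PfinC p n m :=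
  tsum_nonneg (absorbedAt_nonneg hp0 hp1 n m)

/-- Nonnegative superharmonic functions that are at least `1` at `0` dominate the absorption
probability. -/
theorem PfinC_le {p : ℝ} (hp0 : 0 ≤ p) (hp1 : p ≤ 1) {n m : ℕ} (hn : 0 < n) (hm : m ≤ n)
    {h : ℕ → ℝ} (h_nonneg : ∀ m, 0 ≤ h m) (h_zero : 1 ≤ h 0)
    (h_super : ∀ j, p * h (j + 2) + (1 - p) * h j ≤ h (j + 1)) : PfinC p n m ≤ h m :=
  (summable_absorbedAt hp0 hp1 hn hm).tsum_le_of_sum_range_le fun T =>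
    sum_absorbedAt_le hp0 hp1 hn h_nonneg h_zero h_super T m hm

theorem PfinC_le_one {p : ℝ} (hp0 : 0 ≤ p) (hp1 : p ≤ 1) {n m : ℕ} (hn : 0 < n) (hm : m ≤ n) :
    PfinC p n m ≤ 1 :=
  PfinC_le (h := fun _ => 1) hp0 hp1 hn hm (by simp) (by simp) (by simp)

theorem PfinC_self (p : ℝ) (n : ℕ) : PfinC p n n = 0 := by
  simp [PfinC_eq_tsum, absorbedAt_self]

theorem PfinC_zero {p : ℝ} (hp0 : 0 ≤ p) (hp1 : p ≤ 1) {n : ℕ} (hn : 0 < n) :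
    PfinC p n 0 = 1 := by
  rw [PfinC_eq_tsum, (summable_absorbedAt hp0 hp1 hn hn.le).tsum_eq_zero_add]
  simp [absorbedAt_zero_succ, absorbedAt_zero_zero p hn]

theorem PfinC_succ {p : ℝ} (hp0 : 0 ≤ p) (hp1 : p ≤ 1) {n j : ℕ} (hj : j + 1 < n) :
    PfinC p n (j + 1) = p * PfinC p n (j + 2) + (1 - p) * PfinC p n j := by
  have hn : 0 < n := by omega
  simp only [PfinC_eq_tsum]
  rw [(summable_absorbedAt hp0 hp1 hn hj.le).tsum_eq_zero_add]
  simp only [absorbedAt_succ_succ p hj, absorbedAt_succ_zero, zero_add]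
  rw [((summable_absorbedAt hp0 hp1 hn hj).mul_left p).tsum_add
    ((summable_absorbedAt hp0 hp1 hn (by omega)).mul_left (1 - p)), tsum_mul_left, tsum_mul_left]

theorem PfinC_flux {p : ℝ} (hp0 : 0 ≤ p) (hp1 : p ≤ 1) {n j : ℕ} (hj : j < n) :
    (1 - p) * PfinC p n j - p * PfinC p n (j + 1) = (1 - p) - p * PfinC p n 1 := by
  induction j with
  | zero => simp [PfinC_zero hp0 hp1 hj]
  | succ j ih => linarith [ih (by omega), PfinC_succ hp0 hp1 hj]

theorem PfinC_le_pow {p : ℝ} (hp1 : p ≤ 1) (hp : 1 - p < p) {n m : ℕ} (hn : 0 < n)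
    (hm : m ≤ n) : PfinC p n m ≤ ((1 - p) / p) ^ m := by
  have hp0 : 0 < p := by linarith
  have hr : 0 ≤ (1 - p) / p := div_nonneg (by linarith) hp0.le
  refine PfinC_le (h := fun m => ((1 - p) / p) ^ m) hp0.le hp1 hn hm (fun m => pow_nonneg hr m)
    (by simp) fun j => le_of_eq ?_
  have : p * ((1 - p) / p) ^ 2 + (1 - p) = (1 - p) / p := by
    field_simp
    ring
  linear_combination ((1 - p) / p) ^ j * this

theorem one_sub_PfinC_le_pow {p : ℝ} (hp0 : 0 ≤ p) (hp : p < 1 - p) {n : ℕ} (hn : 0 < n)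
    (k : ℕ) (hk : k ≤ n) : 1 - PfinC p n (n - k) ≤ (p / (1 - p)) ^ k := by
  have hp1 : p ≤ 1 := by linarith
  have hq : 0 < 1 - p := by linarith
  induction k with
  | zero => simp [PfinC_self]
  | succ k ih =>
    have flux := PfinC_flux hp0 hp1 (n := n) (j := n - (k + 1)) (by omega)
    rw [show n - (k + 1) + 1 = n - k by omega] at flux
    have h1 : p * PfinC p n 1 ≤ p := mul_le_of_le_one_right hp0 (PfinC_le_one hp0 hp1 hn hn)
    calc 1 - PfinC p n (n - (k + 1)) ≤ p / (1 - p) * (1 - PfinC p n (n - k)) := by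
          rw [div_mul_eq_mul_div, le_div_iff₀ hq]
          linarith
      _ ≤ p / (1 - p) * (p / (1 - p)) ^ k :=
          mul_le_mul_of_nonneg_left (ih (by omega)) (div_nonneg hp0 hq.le)
      _ = (p / (1 - p)) ^ (k + 1) := (pow_succ' _ _).symm

theorem PfinC_half {n m : ℕ} (hn : 0 < n) (hm : m ≤ n) :
    PfinC (1 / 2) n m = 1 - (m : ℝ) / n := by
  have linear : ∀ j ≤ n, PfinC (1 / 2) n j = 1 - j * (1 - PfinC (1 / 2) n 1) := by
    intro j hj
    induction j with
    | zero => rw [PfinC_zero (by norm_num) (by norm_num) hn]; simp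
    | succ j ih =>
      have flux := PfinC_flux (p := 1 / 2) (by norm_num) (by norm_num) (n := n) (j := j) hj
      have := ih (by omega)
      push_cast
      linarith
  have hn' : (n : ℝ) ≠ 0 := by positivity
  have h := linear n le_rfl
  rw [PfinC_self] at h
  have slope : 1 - PfinC (1 / 2) n 1 = 1 / n := by
    field_simp
    linarith
  rw [linear m hm, slope, mul_one_div]

theorem floor_mul_le {c : ℝ} (hc1 : c < 1) (n : ℕ) : ⌊c * (n : ℝ)⌋₊ ≤ n :=
  Nat.floor_le_of_le (by nlinarith [(Nat.cast_nonneg n : (0 : ℝ) ≤ n)])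

theorem tendsto_floor_mul_atTop {c : ℝ} (hc0 : 0 < c) :
    Tendsto (fun n : ℕ => ⌊c * (n : ℝ)⌋₊) atTop atTop :=
  tendsto_nat_floor_atTop.comp (tendsto_natCast_atTop_atTop.const_mul_atTop hc0)

theorem tendsto_sub_floor_mul_atTop {c : ℝ} (hc0 : 0 < c) (hc1 : c < 1) :
    Tendsto (fun n : ℕ => n - ⌊c * (n : ℝ)⌋₊) atTop atTop := by
  refine tendsto_atTop_mono (fun n => ?_) (tendsto_floor_mul_atTop (sub_pos.2 hc1))
  refine Nat.floor_le_of_le ?_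
  rw [Nat.cast_sub (floor_mul_le hc1 n)]
  linarith [Nat.floor_le (show 0 ≤ c * (n : ℝ) by positivity)]

theorem finite_classical_absorption_ray_limit (p : ℝ) (hp0 : 0 ≤ p) (hp1 : p ≤ 1)
    (c : ℝ) (hc0 : 0 < c) (hc1 : c < 1) :
    (1 - p < p → Tendsto (fun n : ℕ => PfinC p n ⌊c * (n : ℝ)⌋₊) atTop (𝓝 0)) ∧
    (p = 1 - p → Tendsto (fun n : ℕ => PfinC p n ⌊c * (n : ℝ)⌋₊) atTop (𝓝 (1 - c))) ∧
    (p < 1 - p → Tendsto (fun n : ℕ => PfinC p n ⌊c * (n : ℝ)⌋₊) atTop (𝓝 1)) := by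
  refine ⟨fun hp => ?_, fun hp => ?_, fun hp => ?_⟩
  · have hlim : Tendsto (fun n : ℕ => ((1 - p) / p) ^ ⌊c * (n : ℝ)⌋₊) atTop (𝓝 0) :=
      (tendsto_pow_atTop_nhds_zero_of_lt_one (div_nonneg (by linarith) hp0)
        ((div_lt_one (by linarith)).2 hp)).comp (tendsto_floor_mul_atTop hc0)
    refine tendsto_of_tendsto_of_tendsto_of_le_of_le' tendsto_const_nhds hlim
      (Eventually.of_forall fun n => PfinC_nonneg hp0 hp1 n _) ?_
    filter_upwards [eventually_gt_atTop 0] with n hn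
    exact PfinC_le_pow hp1 hp hn (floor_mul_le hc1 n)
  · obtain rfl : p = 1 / 2 := by linarith
    have hlim : Tendsto (fun n : ℕ => 1 - (⌊c * (n : ℝ)⌋₊ : ℝ) / n) atTop (𝓝 (1 - c)) :=
      ((tendsto_nat_floor_mul_div_atTop hc0.le).comp tendsto_natCast_atTop_atTop).const_sub 1
    refine hlim.congr' ?_
    filter_upwards [eventually_gt_atTop 0] with n hn
    exact (PfinC_half hn (floor_mul_le hc1 n)).symm
  · have hlim : Tendsto (fun n : ℕ => 1 - (p / (1 - p)) ^ (n - ⌊c * (n : ℝ)⌋₊)) atTop (𝓝 1) := by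
      simpa using ((tendsto_pow_atTop_nhds_zero_of_lt_one (div_nonneg hp0 (by linarith))
        ((div_lt_one (by linarith)).2 hp)).comp (tendsto_sub_floor_mul_atTop hc0 hc1)).const_sub 1
    refine tendsto_of_tendsto_of_tendsto_of_le_of_le' hlim tendsto_const_nhds ?_ ?_
    · filter_upwards [eventually_gt_atTop 0] with n hn
      have := one_sub_PfinC_le_pow hp0 hp hn (n - ⌊c * (n : ℝ)⌋₊) (Nat.sub_le _ _)
      rw [Nat.sub_sub_self (floor_mul_le hc1 n)] at this
      linarith
    · filter_upwards [eventually_gt_atTop 0] with n hn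
      exact PfinC_le_one hp0 hp1 hn (floor_mul_le hc1 n)
end

section
/- Let 0 < m < n be integers. Let ω = 1/3 + (2√2/3)i, let δ_±(z) = (1/2)·[−(3z² + 4z + 3) ± √((3z² + 4z + 3)² − 4z²)] (principal square root), F_k(z) = δ_+(z)^k − δ_−(z)^k, and B_k(z) = δ_+(z)^k + δ_−(z)^k. Then the finite left absorption probability of the three-state Grover walk satisfies P_n^{(m)}(1,0,0) = (1/2)·[F_{n−m}(1)·F_{m−1}(1)/(√6·F_{n−1}(1)) − F_{n−m}(ω)·B_{m−1}(ω)/(√2·B_{n−1}(ω))]. -/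
open scoped Classical
open Filter Topology

/-- Step value of a three-state internal state: `0` = R ↦ +1, `1` = S ↦ 0, `2` = L ↦ −1. -/
def gstep (σ : Fin 3) : ℤ := 1 - (σ : ℤ)

/-- Step amplitudes of the three-state Grover walk: `A(σ→σ) = −1/3`, `A(σ→σ') = 2/3` for σ ≠ σ'. -/
noncomputable def gamp (σ σ' : Fin 3) : ℝ := if σ = σ' then -1/3 else 2/3

/-- Amplitude `A(γ) = Π_{k=1}^t A(σ_{k−1}→σ_k)` of a `t`-path `γ = (σ_0, …, σ_t)`. -/
noncomputable def gpamp {t : ℕ} (γ : Fin (t + 1) → Fin 3) : ℝ :=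
  ∏ k : Fin t, gamp (γ k.castSucc) (γ k.succ)

/-- Partial displacement `S_k(γ) = σ_1 + ⋯ + σ_k` of a `t`-path `γ = (σ_0, …, σ_t)`. -/
def gS {t : ℕ} (γ : Fin (t + 1) → Fin 3) (k : ℕ) : ℤ :=
  ∑ i ∈ Finset.univ.filter (fun i : Fin t => (i : ℕ) < k), gstep (γ i.succ)

/-- `c_t` for the semi-infinite walk: sum of `A(γ)` over `t`-paths with `σ_0 = R`, `σ_t = L`,
`S_t(γ) = −m`, and `S_k(γ) > −m` for all `k < t`. -/
noncomputable def gcInf (m : ℕ) (t : ℕ) : ℝ :=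
  ∑ γ ∈ Finset.univ.filter (fun γ : Fin (t + 1) → Fin 3 =>
      γ 0 = 0 ∧ γ (Fin.last t) = 2 ∧ gS γ t = -(m : ℤ) ∧
      ∀ k < t, -(m : ℤ) < gS γ k),
    gpamp γ

/-- `c_t` for the finite walk: sum of `A(γ)` over `t`-paths with `σ_0 = R`, `σ_t = L`,
`S_t(γ) = −m`, and `−m < S_k(γ) < n − m` for all `k < t`. -/
noncomputable def gcFin (n m : ℕ) (t : ℕ) : ℝ :=
  ∑ γ ∈ Finset.univ.filter (fun γ : Fin (t + 1) → Fin 3 =>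
      γ 0 = 0 ∧ γ (Fin.last t) = 2 ∧ gS γ t = -(m : ℤ) ∧
      ∀ k < t, -(m : ℤ) < gS γ k ∧ gS γ k < (n : ℤ) - (m : ℤ)),
    gpamp γ

/-- Semi-infinite left absorption probability `P_∞^{(m)}(1,0,0)` of the Grover walk. -/
noncomputable def GPinf (m : ℕ) : ℝ := ∑' t : ℕ, (gcInf m t) ^ 2

/-- Finite left absorption probability `P_n^{(m)}(1,0,0)` of the Grover walk. -/
noncomputable def GPfin (n m : ℕ) : ℝ := ∑' t : ℕ, (gcFin n m t) ^ 2

/-- Principal square root on `ℂ`. -/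
noncomputable def csqrt (z : ℂ) : ℂ := z ^ ((1 : ℂ) / 2)

/-- `δ_±(z) = (1/2)[−(3z² + 4z + 3) ± √((3z² + 4z + 3)² − 4z²)]`. -/
noncomputable def deltaP (z : ℂ) : ℂ :=
  (1 / 2) * (-(3 * z ^ 2 + 4 * z + 3) + csqrt ((3 * z ^ 2 + 4 * z + 3) ^ 2 - 4 * z ^ 2))

noncomputable def deltaM (z : ℂ) : ℂ :=
  (1 / 2) * (-(3 * z ^ 2 + 4 * z + 3) - csqrt ((3 * z ^ 2 + 4 * z + 3) ^ 2 - 4 * z ^ 2))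

/-- `F_k(z) = δ_+(z)^k − δ_−(z)^k`. -/
noncomputable def Fk (k : ℕ) (z : ℂ) : ℂ := deltaP z ^ k - deltaM z ^ k

/-- `B_k(z) = δ_+(z)^k + δ_−(z)^k`. -/
noncomputable def Bk (k : ℕ) (z : ℂ) : ℂ := deltaP z ^ k + deltaM z ^ k

/-- `ω = 1/3 + (2√2/3)i`. -/
noncomputable def omg : ℂ := 1 / 3 + (2 * Real.sqrt 2 / 3) * Complex.I

/-- The square-sum of the Taylor coefficients of a function holomorphic across the unit circle. -/
theorem hasSum_sq_circleAverage {G : ℂ → ℂ} {s : Set ℂ} (hs : IsOpen s)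
    (hsub : Metric.closedBall 0 1 ⊆ s) (hG : DifferentiableOn ℂ G s) {c : ℕ → ℂ}
    (hc : ∀ᶠ z in 𝓝 (0 : ℂ), HasSum (fun t => c t * z ^ t) (G z)) :
    HasSum (fun t => c t ^ 2) (Real.circleAverage (fun z => G z * G z⁻¹) 0 1) := by
  obtain ⟨δ, hδ, hδs⟩ :=
    (isCompact_closedBall (0 : ℂ) 1).exists_cthickening_subset_open hs hsub
  rw [cthickening_closedBall hδ.le zero_le_one] at hδs
  obtain ⟨R, hR1, hR⟩ : ∃ R : NNReal, 1 < R ∧ Metric.closedBall (0 : ℂ) R ⊆ s :=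
    ⟨⟨δ + 1, by positivity⟩, show (1 : ℝ) < δ + 1 by linarith, hδs⟩
  have hcAt : HasFPowerSeriesAt G (FormalMultilinearSeries.ofScalars ℂ c) 0 := by
    rw [hasFPowerSeriesAt_iff]
    filter_upwards [hc] with z hz
    simpa [FormalMultilinearSeries.coeff_ofScalars, mul_comm] using hz
  have hbig : HasFPowerSeriesOnBall G (FormalMultilinearSeries.ofScalars ℂ c) 0 R := by
    have h := (hG.mono hR).hasFPowerSeriesOnBall (zero_lt_one.trans hR1)
    rwa [h.hasFPowerSeriesAt.eq_formalMultilinearSeries hcAt] at h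
  have hcoef : ∀ t, Real.circleAverage (fun z => (z⁻¹) ^ t * G z) 0 1 = c t := by
    intro t
    have h := DifferentiableOn.hasFPowerSeriesOnBall (R := 1) (hG.mono hsub) zero_lt_one
    have h2 := h.hasFPowerSeriesAt.eq_formalMultilinearSeries hcAt
    have h3 := congrArg (fun p : FormalMultilinearSeries ℂ ℂ ℂ => p.coeff t) h2
    simp only [FormalMultilinearSeries.coeff_ofScalars] at h3
    rw [← h3, Real.circleAverage_eq_circleIntegral one_ne_zero]
    have h4 := cauchyPowerSeries_apply G 0 1 t 1
    rw [FormalMultilinearSeries.coeff]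
    refine Eq.trans ?_ h4.symm
    congr 2
    ext z
    simp [smul_eq_mul]
    ring
  have hnorm : Summable fun t => ‖c t‖ := by
    have h1 : (1 : NNReal) < (FormalMultilinearSeries.ofScalars ℂ c).radius := by
      exact lt_of_lt_of_le (ENNReal.coe_lt_coe.2 hR1) hbig.r_le
    have h2 := (FormalMultilinearSeries.ofScalars ℂ c).summable_norm_mul_pow h1
    simpa [FormalMultilinearSeries.ofScalars_norm] using h2
  have hval : ∀ z : ℂ, ‖z‖ = 1 → HasSum (fun t => c t * z ^ t) (G z) := by
    intro z hz
    have h := hbig.hasSum (y := z) (by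
      rw [Metric.mem_eball, edist_zero_right, ← ofReal_norm, hz, ENNReal.ofReal_one,
        ← ENNReal.coe_one, ENNReal.coe_lt_coe]
      exact hR1)
    simpa [FormalMultilinearSeries.ofScalars_apply_eq, mul_comm] using h
  have hcont : Continuous fun θ : ℝ => G (circleMap 0 1 θ) := by
    refine hG.continuousOn.comp_continuous (continuous_circleMap 0 1) fun θ => hsub ?_
    simp [circleMap]
  obtain ⟨C, hC⟩ : ∃ C, ∀ θ ∈ Set.Icc 0 (2 * Real.pi), ‖G (circleMap 0 1 θ)‖ ≤ C :=
    isCompact_Icc.exists_bound_of_continuousOn hcont.continuousOn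
  have hsq : ∀ t, c t ^ 2 = (2 * Real.pi)⁻¹ •
      ∫ θ in (0 : ℝ)..2 * Real.pi, c t * (circleMap 0 1 θ)⁻¹ ^ t * G (circleMap 0 1 θ) := by
    intro t
    rw [pow_two]
    nth_rewrite 2 [← hcoef t]
    rw [Real.circleAverage]
    simp only [mul_assoc, intervalIntegral.integral_const_mul, Complex.real_smul]
    ring
  simp only [hsq]
  rw [Real.circleAverage]
  refine HasSum.const_smul _ ?_
  refine intervalIntegral.hasSum_integral_of_dominated_convergence
    (fun t _ => ‖c t‖ * C) ?_ ?_ ?_ ?_ ?_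
  · intro t
    refine Continuous.aestronglyMeasurable ?_
    refine (continuous_const.mul (Continuous.pow ?_ t)).mul hcont
    exact (continuous_circleMap 0 1).inv₀ fun θ => circleMap_ne_center one_ne_zero
  · intro t
    refine Eventually.of_forall fun θ hθ => ?_
    rw [Set.uIoc_of_le (by positivity)] at hθ
    have := hC θ ⟨hθ.1.le, hθ.2⟩
    simp only [norm_mul, norm_pow, norm_inv, norm_circleMap_zero, abs_one, inv_one, one_pow,
      mul_one]
    gcongr
  · exact Eventually.of_forall fun θ _ => hnorm.mul_right C
  · exact intervalIntegrable_const
  · refine Eventually.of_forall fun θ _ => ?_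
    have := (hval (circleMap 0 1 θ)⁻¹ (by simp)).mul_right (G (circleMap 0 1 θ))
    simpa [mul_comm, mul_assoc, mul_left_comm] using this

/-- If `G(z) G(1/z) = g(z) + g(1/z)` on the unit circle up to finitely many points, then the
square-sum of the Taylor coefficients of `G` is `2 g(0)`. -/
theorem hasSum_sq_of_mul_inv_eq {G g : ℂ → ℂ} {s S : Set ℂ} (hs : IsOpen s)
    (hsub : Metric.closedBall 0 1 ⊆ s) (hG : DifferentiableOn ℂ G s)
    (hg : DifferentiableOn ℂ g s) (hS : S.Finite)
    (hid : ∀ z : ℂ, ‖z‖ = 1 → z ∉ S → G z * G z⁻¹ = g z + g z⁻¹) {c : ℕ → ℂ}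
    (hc : ∀ᶠ z in 𝓝 (0 : ℂ), HasSum (fun t => c t * z ^ t) (G z)) :
    HasSum (fun t => c t ^ 2) (2 * g 0) := by
  have h := hasSum_sq_circleAverage hs hsub hG hc
  have havg : Real.circleAverage g 0 1 = g 0 := by
    refine DiffContOnCl.circleAverage (DifferentiableOn.diffContOnCl (hg.mono ?_))
    rw [abs_one, closure_ball _ one_ne_zero]
    exact hsub
  have hint : CircleIntegrable g 0 1 := by
    refine ContinuousOn.circleIntegrable zero_le_one (hg.continuousOn.mono ?_)
    exact Metric.sphere_subset_closedBall.trans hsub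
  have hint' : CircleIntegrable (fun z => g z⁻¹) 0 1 := by
    refine ContinuousOn.circleIntegrable zero_le_one (hg.continuousOn.comp ?_ ?_)
    · exact continuousOn_id.inv₀ fun z hz h0 => by simp_all
    · intro z hz
      refine hsub ?_
      simp_all
  have hcongr : Real.circleAverage (fun z => G z * G z⁻¹) 0 1 =
      Real.circleAverage (fun z => g z + g z⁻¹) 0 1 := by
    refine Real.circleAverage_congr_codiscreteWithin ?_ one_ne_zero
    filter_upwards [compl_finite_mem_codiscreteWithin hS, self_mem_codiscreteWithin _]
      with z hz hz1
    exact hid z (by simpa using hz1) hz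
  rw [hcongr, Real.circleAverage_fun_add hint hint', Real.circleAverage_zero_one_congr_inv, havg,
    ← two_mul] at h
  exact h

/-- The amplitude with which the walk on `{1, …, n - 1}`, started at position `x` with internal
state `σ`, exits at `0` at time `t`. -/
noncomputable def exitAmp (n : ℤ) (t : ℕ) (σ : Fin 3) (x : ℤ) : ℝ :=
  ∑ γ ∈ Finset.univ.filter (fun γ : Fin (t + 1) → Fin 3 =>
      γ 0 = σ ∧ γ (Fin.last t) = 2 ∧ gS γ t = -x ∧
      ∀ k < t, -x < gS γ k ∧ gS γ k < n - x),
    gpamp γ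

theorem gS_zero {t : ℕ} (γ : Fin (t + 1) → Fin 3) : gS γ 0 = 0 := by
  simp [gS]

theorem gS_cons_succ {t : ℕ} (a : Fin 3) (γ : Fin (t + 1) → Fin 3) (k : ℕ) :
    gS (t := t + 1) (Fin.cons a γ) (k + 1) = gstep (γ 0) + gS γ k := by
  simp [gS, Finset.sum_filter, Fin.sum_univ_succ]

theorem gpamp_cons {t : ℕ} (a : Fin 3) (γ : Fin (t + 1) → Fin 3) :
    gpamp (t := t + 1) (Fin.cons a γ) = gamp a (γ 0) * gpamp γ := by
  simp [gpamp, Fin.prod_univ_succ]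

theorem exitAmp_zero (n : ℤ) (σ : Fin 3) (x : ℤ) :
    exitAmp n 0 σ x = if σ = 2 ∧ x = 0 then 1 else 0 := by
  rw [exitAmp, Finset.sum_filter, ← (Equiv.funUnique (Fin 1) (Fin 3)).symm.sum_comp]
  simp only [gpamp, gS]
  by_cases h : σ = 2 <;> by_cases hx : x = 0 <;> simp [h, hx, eq_comm, ite_and]

theorem exitAmp_succ_of_not_mem {n x : ℤ} (hx : ¬(0 < x ∧ x < n)) (t : ℕ) (σ : Fin 3) :
    exitAmp n (t + 1) σ x = 0 := by
  rw [exitAmp, Finset.sum_eq_zero]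
  intro γ hγ
  have h := (Finset.mem_filter.1 hγ).2.2.2.2 0 (Nat.succ_pos t)
  rw [gS_zero] at h
  exact absurd ⟨by linarith, by linarith⟩ hx

theorem exitAmp_succ {n x : ℤ} (hx : 0 < x) (hxn : x < n) (t : ℕ) (σ : Fin 3) :
    exitAmp n (t + 1) σ x = ∑ σ', gamp σ σ' * exitAmp n t σ' (x + gstep σ') := by
  have hiff : ∀ (a : Fin 3) (γ : Fin (t + 1) → Fin 3),
      ((Fin.cons a γ : Fin (t + 2) → Fin 3) 0 = σ ∧
        (Fin.cons a γ : Fin (t + 2) → Fin 3) (Fin.last (t + 1)) = 2 ∧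
        gS (t := t + 1) (Fin.cons a γ) (t + 1) = -x ∧
        ∀ k < t + 1, -x < gS (t := t + 1) (Fin.cons a γ) k ∧
          gS (t := t + 1) (Fin.cons a γ) k < n - x) ↔
      a = σ ∧ (γ (Fin.last t) = 2 ∧ gS γ t = -(x + gstep (γ 0)) ∧
        ∀ k < t, -(x + gstep (γ 0)) < gS γ k ∧ gS γ k < n - (x + gstep (γ 0))) := by
    intro a γ
    rw [← Fin.succ_last, Fin.cons_succ, Fin.cons_zero, gS_cons_succ]
    refine and_congr_right fun _ => and_congr_right fun _ => and_congr ?_ ?_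
    · constructor <;> intro h <;> linarith
    · constructor
      · intro h k hk
        have := h (k + 1) (by omega)
        rw [gS_cons_succ] at this
        constructor <;> linarith
      · intro h k hk
        cases k with
        | zero => rw [gS_zero]; constructor <;> linarith
        | succ k =>
          have := h k (by omega)
          rw [gS_cons_succ]
          constructor <;> linarith
  have hleft : exitAmp n (t + 1) σ x = ∑ γ : Fin (t + 1) → Fin 3,
      if (γ (Fin.last t) = 2 ∧ gS γ t = -(x + gstep (γ 0)) ∧
        ∀ k < t, -(x + gstep (γ 0)) < gS γ k ∧ gS γ k < n - (x + gstep (γ 0)))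
      then gamp σ (γ 0) * gpamp γ else 0 := by
    have hsum : ∀ f : (Fin (t + 2) → Fin 3) → ℝ,
        ∑ γ, f γ = ∑ a : Fin 3, ∑ γ : Fin (t + 1) → Fin 3, f (Fin.cons a γ) := by
      intro f
      rw [← (Fin.consEquiv fun _ : Fin (t + 2) => Fin 3).sum_comp, Fintype.sum_prod_type]
      rfl
    rw [exitAmp, Finset.sum_filter, hsum, Finset.sum_comm]
    refine Finset.sum_congr rfl fun γ _ => ?_
    simp only [hiff, gpamp_cons, ite_and (_ = σ)]
    simp
  have hright : ∀ σ', gamp σ σ' * exitAmp n t σ' (x + gstep σ') =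
      ∑ γ : Fin (t + 1) → Fin 3, if γ 0 = σ' then
        (if (γ (Fin.last t) = 2 ∧ gS γ t = -(x + gstep (γ 0)) ∧
          ∀ k < t, -(x + gstep (γ 0)) < gS γ k ∧ gS γ k < n - (x + gstep (γ 0)))
        then gamp σ (γ 0) * gpamp γ else 0) else 0 := by
    intro σ'
    rw [exitAmp, Finset.sum_filter, Finset.mul_sum]
    refine Finset.sum_congr rfl fun γ _ => ?_
    by_cases h : γ 0 = σ'
    · simp [h]
    · simp [h]
  simp only [hright]
  rw [Finset.sum_comm, hleft]
  simp

theorem abs_exitAmp_le (n : ℤ) (t : ℕ) (σ : Fin 3) (x : ℤ) : |exitAmp n t σ x| ≤ 3 ^ t := by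
  induction t generalizing σ x with
  | zero => rw [exitAmp_zero]; split_ifs <;> simp
  | succ t ih =>
    by_cases hx : 0 < x ∧ x < n
    · rw [exitAmp_succ hx.1 hx.2]
      refine (Finset.abs_sum_le_sum_abs _ _).trans ?_
      calc ∑ σ', |gamp σ σ' * exitAmp n t σ' (x + gstep σ')| ≤ ∑ _σ' : Fin 3, (3 : ℝ) ^ t := by
            refine Finset.sum_le_sum fun σ' _ => ?_
            rw [abs_mul]
            have h1 : |gamp σ σ'| ≤ 1 := by
              rw [gamp]; split_ifs <;> norm_num [abs_le]
            calc _ ≤ 1 * (3 : ℝ) ^ t := by gcongr; exact ih _ _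
              _ = _ := one_mul _
        _ = 3 ^ (t + 1) := by simp; ring
    · rw [exitAmp_succ_of_not_mem hx]; simp

/-- The generating function of `exitAmp`. -/
noncomputable def exitGF (n : ℤ) (z : ℂ) (σ : Fin 3) (x : ℤ) : ℂ :=
  ∑' t : ℕ, (exitAmp n t σ x : ℂ) * z ^ t

theorem hasSum_exitGF (n : ℤ) {z : ℂ} (hz : ‖z‖ < 1 / 3) (σ : Fin 3) (x : ℤ) :
    HasSum (fun t : ℕ => (exitAmp n t σ x : ℂ) * z ^ t) (exitGF n z σ x) := by
  refine Summable.hasSum (Summable.of_norm_bounded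
    (summable_geometric_of_lt_one (r := 3 * ‖z‖) (by positivity) (by linarith)) fun t => ?_)
  rw [norm_mul, norm_pow, mul_pow, Complex.norm_real]
  gcongr
  exact abs_exitAmp_le n t σ x

theorem exitGF_of_not_mem {n x : ℤ} (hx : ¬(0 < x ∧ x < n)) (z : ℂ) (σ : Fin 3) :
    exitGF n z σ x = if σ = 2 ∧ x = 0 then 1 else 0 := by
  rw [exitGF, tsum_eq_single 0]
  · rw [exitAmp_zero]; split_ifs <;> simp
  · intro t ht
    obtain ⟨t, rfl⟩ := Nat.exists_eq_succ_of_ne_zero ht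
    rw [exitAmp_succ_of_not_mem hx]; simp

theorem exitGF_eq {n x : ℤ} (hx : 0 < x) (hxn : x < n) {z : ℂ} (hz : ‖z‖ < 1 / 3) (σ : Fin 3) :
    exitGF n z σ x = z * ∑ σ', (gamp σ σ' : ℂ) * exitGF n z σ' (x + gstep σ') := by
  rw [exitGF, (hasSum_exitGF n hz σ x).summable.tsum_eq_zero_add, exitAmp_zero, if_neg (by omega)]
  have h : HasSum (fun t : ℕ => z * ∑ σ', (gamp σ σ' : ℂ) *
      ((exitAmp n t σ' (x + gstep σ') : ℂ) * z ^ t))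
      (z * ∑ σ', (gamp σ σ' : ℂ) * exitGF n z σ' (x + gstep σ')) :=
    (hasSum_sum fun σ' _ => (hasSum_exitGF n hz σ' _).mul_left _).mul_left _
  rw [← h.tsum_eq]
  simp only [Complex.ofReal_zero, zero_mul, zero_add]
  refine tsum_congr fun t => ?_
  rw [exitAmp_succ hx hxn]
  push_cast
  rw [Finset.sum_mul, Finset.mul_sum]
  refine Finset.sum_congr rfl fun σ' _ => ?_
  ring

/-- Eliminating the resting state: the scattering relations at a single site. -/
theorem exitGF_scattering {n x : ℤ} (hx : 0 < x) (hxn : x < n) {z : ℂ} (hz : ‖z‖ < 1 / 3) :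
    (3 + z) * exitGF n z 0 x =
        2 * z * (z + 1) * exitGF n z 2 (x - 1) + z * (z - 1) * exitGF n z 0 (x + 1) ∧
      (3 + z) * exitGF n z 2 x =
        2 * z * (z + 1) * exitGF n z 0 (x + 1) + z * (z - 1) * exitGF n z 2 (x - 1) := by
  have h0 := exitGF_eq hx hxn hz 0
  have h1 := exitGF_eq hx hxn hz 1
  have h2 := exitGF_eq hx hxn hz 2
  simp only [Fin.sum_univ_three, gamp, gstep] at h0 h1 h2
  norm_num [← sub_eq_add_neg, show (0 : Fin 3) ≠ 2 by decide, show (1 : Fin 3) ≠ 2 by decide,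
    show (2 : Fin 3) ≠ 0 by decide, show (2 : Fin 3) ≠ 1 by decide] at h0 h1 h2
  constructor
  · linear_combination (3 + z) * h0 + 2 * z * h1
  · linear_combination (3 + z) * h2 + 2 * z * h1

/-- The Lucas sequence with parameters `-(3z² + 4z + 3)` and `z²`. -/
noncomputable def lucasU (z : ℂ) : ℕ → ℂ
  | 0 => 0
  | 1 => 1
  | j + 2 => -(3 * z ^ 2 + 4 * z + 3) * lucasU z (j + 1) - z ^ 2 * lucasU z j

/-- The companion Lucas sequence. -/
noncomputable def lucasV (z : ℂ) (j : ℕ) : ℂ :=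
  2 * lucasU z (j + 1) + (3 * z ^ 2 + 4 * z + 3) * lucasU z j

/-- The denominator of the transmission amplitude through `j` consecutive sites. -/
noncomputable def transDen (j : ℕ) (z : ℂ) : ℂ :=
  (z - 1) * lucasU z (j + 1) + z ^ 2 * (3 * z + 1) * lucasU z j

theorem three_add_mul_lucasU (z : ℂ) (j : ℕ) :
    (3 + z) * lucasU z (j + 1) = transDen (j + 1) z + z ^ 2 * (z - 1) * lucasU z j := by
  rw [transDen, lucasU]; ring

theorem sub_one_mul_transDen_succ (z : ℂ) (j : ℕ) :
    (z - 1) * transDen (j + 1) z =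
      (3 + z) * transDen j z - 4 * z ^ 2 * (z + 1) ^ 2 * lucasU z j := by
  rw [transDen, transDen, lucasU]; ring

theorem two_mul_transDen (z : ℂ) (j : ℕ) :
    2 * transDen j z =
      (z - 1) * lucasV z j + (z + 1) * (3 * z ^ 2 - 2 * z + 3) * lucasU z j := by
  rw [transDen, lucasV]; ring

theorem lucasU_mul_lucasV_sub (z : ℂ) (N M : ℕ) :
    lucasU z (N + M) * lucasV z M - lucasV z (N + M) * lucasU z M =
      2 * (z ^ M) ^ 2 * lucasU z N := by
  have h : lucasU z (N + M) * lucasU z (M + 1) - lucasU z (N + M + 1) * lucasU z M =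
      (z ^ M) ^ 2 * lucasU z N := by
    induction M with
    | zero => simp [lucasU]
    | succ M ih =>
      rw [← add_assoc, lucasU, lucasU, pow_succ]
      linear_combination z ^ 2 * ih
  rw [lucasV, lucasV]
  linear_combination 2 * h

theorem lucasU_inv {z : ℂ} (hz : z ≠ 0) (j : ℕ) :
    lucasU z⁻¹ j * (z ^ j) ^ 2 = z ^ 2 * lucasU z j := by
  induction j using Nat.twoStepInduction with
  | zero => simp [lucasU]
  | one => simp [lucasU]
  | more j ih1 ih2 =>
    have h : lucasU z⁻¹ (j + 2) * (z ^ (j + 2)) ^ 2 =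
        -(3 * z ^ 2 + 4 * z + 3) * (lucasU z⁻¹ (j + 1) * (z ^ (j + 1)) ^ 2) -
          z ^ 2 * (lucasU z⁻¹ j * (z ^ j) ^ 2) := by
      rw [lucasU]
      field_simp
      ring
    rw [h, ih1, ih2, lucasU]
    ring

theorem lucasV_inv {z : ℂ} (hz : z ≠ 0) (j : ℕ) :
    lucasV z⁻¹ j * (z ^ j) ^ 2 = lucasV z j := by
  have h1 := lucasU_inv hz j
  have h2 := lucasU_inv hz (j + 1)
  have h3 : lucasV z⁻¹ j * (z ^ j) ^ 2 =
      2 * (lucasU z⁻¹ (j + 1) * (z ^ (j + 1)) ^ 2) / z ^ 2 +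
        (3 * z ^ 2 + 4 * z + 3) * (lucasU z⁻¹ j * (z ^ j) ^ 2) / z ^ 2 := by
    rw [lucasV]
    field_simp
    ring
  rw [h3, h1, h2, lucasV]
  field_simp

theorem lucasU_mul_sub {z p q : ℂ} (hs : p + q = -(3 * z ^ 2 + 4 * z + 3)) (hp : p * q = z ^ 2)
    (j : ℕ) : lucasU z j * (p - q) = p ^ j - q ^ j := by
  induction j using Nat.twoStepInduction with
  | zero => simp [lucasU]
  | one => simp [lucasU]
  | more j ih1 ih2 =>
    rw [lucasU, ← hs, ← hp]
    linear_combination (p + q) * ih2 - p * q * ih1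

theorem lucasV_eq {z p q : ℂ} (hs : p + q = -(3 * z ^ 2 + 4 * z + 3)) (hp : p * q = z ^ 2)
    (hpq : p ≠ q) (j : ℕ) : lucasV z j = p ^ j + q ^ j := by
  have h1 := lucasU_mul_sub hs hp j
  have h2 := lucasU_mul_sub hs hp (j + 1)
  refine mul_right_cancel₀ (sub_ne_zero.2 hpq) ?_
  rw [lucasV]
  linear_combination 2 * h2 - (p + q) * h1 + lucasU z j * (p - q) * hs

theorem differentiable_lucasU (j : ℕ) : Differentiable ℂ fun z => lucasU z j := by
  induction j using Nat.twoStepInduction with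
  | zero => simp [lucasU]
  | one => simp [lucasU]
  | more j ih1 ih2 => simp only [lucasU]; fun_prop

theorem differentiable_lucasV (j : ℕ) : Differentiable ℂ fun z => lucasV z j := by
  have h1 := differentiable_lucasU j
  have h2 := differentiable_lucasU (j + 1)
  simp only [lucasV]; fun_prop

theorem differentiable_transDen (j : ℕ) : Differentiable ℂ (transDen j) := by
  have h1 := differentiable_lucasU j
  have h2 := differentiable_lucasU (j + 1)
  unfold transDen; fun_prop

theorem norm_scattering_le {z d e : ℂ} (hz : ‖z‖ ≤ 1) (he : ‖e‖ ≤ ‖d‖) :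
    ‖2 * (z + 1) * d - (1 + 3 * z) * e‖ ≤ ‖(3 + z) * d - 2 * (z + 1) * e‖ := by
  have key : Complex.normSq ((3 + z) * d - 2 * (z + 1) * e) -
      Complex.normSq (2 * (z + 1) * d - (1 + 3 * z) * e) =
      4 * (1 - Complex.normSq z) * Complex.normSq (d - e) +
        Complex.normSq (1 - z) * (Complex.normSq d - Complex.normSq e) := by
    simp [Complex.normSq_apply]
    ring
  simp only [Complex.normSq_eq_norm_sq] at key
  refine le_of_sq_le_sq ?_ (norm_nonneg _)
  have h1 : 0 ≤ 1 - ‖z‖ ^ 2 := by nlinarith [norm_nonneg z]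
  have h2 : 0 ≤ ‖d‖ ^ 2 - ‖e‖ ^ 2 := by nlinarith [norm_nonneg e]
  have h3 := mul_nonneg (mul_nonneg (by norm_num : (0 : ℝ) ≤ 4) h1) (sq_nonneg ‖d - e‖)
  have h4 := mul_nonneg (sq_nonneg ‖1 - z‖) h2
  linarith

theorem two_mul_norm_add_one_lt {z : ℂ} (hz : ‖z‖ ≤ 1) (hz1 : z ≠ 1) :
    2 * ‖z + 1‖ < ‖3 + z‖ := by
  refine lt_of_pow_lt_pow_left₀ 2 (norm_nonneg _) ?_
  rw [mul_pow, ← Complex.normSq_eq_norm_sq, ← Complex.normSq_eq_norm_sq]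
  have h : Complex.normSq z ≤ 1 := by
    rw [Complex.normSq_eq_norm_sq]; nlinarith [norm_nonneg z]
  simp only [Complex.normSq_apply, Complex.add_re, Complex.add_im, Complex.one_re, Complex.one_im,
    Complex.re_ofNat, Complex.im_ofNat] at h ⊢
  have hre : z.re < 1 := by
    refine lt_of_le_of_ne (by nlinarith [mul_self_nonneg z.im, sq_nonneg (z.re - 1)]) fun hre => ?_
    exact hz1 (Complex.ext hre (by rw [hre] at h; simpa using (by nlinarith : z.im ^ 2 = 0)))
  nlinarith

theorem norm_refl_le_transDen {z : ℂ} (hz : ‖z‖ ≤ 1) (hz1 : z ≠ 1) (j : ℕ) :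
    transDen j z ≠ 0 ∧ ‖2 * z * (z + 1) * lucasU z j‖ ≤ ‖transDen j z‖ := by
  have hz1' : 0 < ‖z - 1‖ := norm_pos_iff.2 (sub_ne_zero.2 hz1)
  induction j with
  | zero => simp [transDen, lucasU, sub_ne_zero.2 hz1]
  | succ j ih =>
    obtain ⟨hne, hle⟩ := ih
    set e := z * (2 * z * (z + 1) * lucasU z j) with he
    have hed : ‖e‖ ≤ ‖transDen j z‖ := by
      rw [he, norm_mul]
      calc _ ≤ 1 * ‖2 * z * (z + 1) * lucasU z j‖ := by gcongr
        _ ≤ _ := by rwa [one_mul]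
    have h1 : (z - 1) * transDen (j + 1) z = (3 + z) * transDen j z - 2 * (z + 1) * e := by
      rw [sub_one_mul_transDen_succ, he]; ring
    have h2 : (z - 1) * (2 * z * (z + 1) * lucasU z (j + 1)) =
        z * (2 * (z + 1) * transDen j z - (1 + 3 * z) * e) := by
      rw [he, transDen]; ring
    constructor
    · intro h0
      rw [h0, mul_zero, eq_comm, sub_eq_zero] at h1
      have h3 := congrArg norm h1
      rw [norm_mul, norm_mul, norm_mul, Complex.norm_ofNat] at h3
      have h4 := two_mul_norm_add_one_lt hz hz1
      have h5 : 0 < ‖transDen j z‖ := norm_pos_iff.2 hne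
      nlinarith [norm_nonneg (z + 1)]
    · refine le_of_mul_le_mul_left ?_ hz1'
      rw [← norm_mul, ← norm_mul, h1, h2, norm_mul]
      calc _ ≤ 1 * ‖2 * (z + 1) * transDen j z - (1 + 3 * z) * e‖ := by gcongr
        _ ≤ _ := by rw [one_mul]; exact norm_scattering_le hz hed

theorem pow_ne_pow_of_norm_lt {p q : ℂ} (h : ‖p‖ < ‖q‖) {j : ℕ} (hj : j ≠ 0) : p ^ j ≠ q ^ j := by
  intro h1
  have h2 := congrArg norm h1
  rw [norm_pow, norm_pow] at h2
  exact (pow_lt_pow_left₀ h (norm_nonneg p) hj).ne h2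

theorem pow_add_pow_ne_zero_of_norm_lt {p q : ℂ} (h : ‖p‖ < ‖q‖) {j : ℕ} (hj : j ≠ 0) :
    p ^ j + q ^ j ≠ 0 := by
  intro h1
  have h2 := congrArg norm (eq_neg_of_add_eq_zero_left h1)
  rw [norm_neg, norm_pow, norm_pow] at h2
  exact (pow_lt_pow_left₀ h (norm_nonneg p) hj).ne h2

theorem ofReal_sqrt_sq {x : ℝ} (hx : 0 ≤ x) : ((Real.sqrt x : ℝ) : ℂ) ^ 2 = x := by
  rw [← Complex.ofReal_pow, Real.sq_sqrt hx]

theorem norm_neg_add_lt {a b : ℝ} (ha : 0 < a) (hb : 0 < b) :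
    ‖(-a + b : ℂ)‖ < ‖(-a - b : ℂ)‖ := by
  have h1 : (-a + b : ℂ) = ((-a + b : ℝ) : ℂ) := by push_cast; ring
  have h2 : (-a - b : ℂ) = ((-a - b : ℝ) : ℂ) := by push_cast; ring
  rw [h1, h2, Complex.norm_real, Complex.norm_real, Real.norm_eq_abs, Real.norm_eq_abs,
    abs_of_neg (by linarith : -a - b < 0)]
  exact abs_lt.2 ⟨by linarith, by linarith⟩

theorem lucasU_one_mul (j : ℕ) : lucasU 1 j * (4 * Real.sqrt 6) =
    (-5 + 2 * Real.sqrt 6) ^ j - (-5 - 2 * Real.sqrt 6) ^ j := by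
  have h6 := ofReal_sqrt_sq (x := 6) (by norm_num)
  push_cast at h6
  rw [← lucasU_mul_sub (z := 1) (by ring) (by linear_combination -4 * h6)]
  ring

theorem lucasU_one_ne_zero {j : ℕ} (hj : j ≠ 0) : lucasU 1 j ≠ 0 := by
  intro h
  have h1 := lucasU_one_mul j
  rw [h, zero_mul, eq_comm, sub_eq_zero] at h1
  have := norm_neg_add_lt (a := 5) (b := 2 * Real.sqrt 6) (by norm_num) (by positivity)
  push_cast at this
  exact pow_ne_pow_of_norm_lt this hj h1

theorem transDen_ne_zero {z : ℂ} (hz : ‖z‖ ≤ 1) {j : ℕ} (hj : j ≠ 0) : transDen j z ≠ 0 := by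
  by_cases hz1 : z = 1
  · subst hz1
    obtain ⟨j, rfl⟩ := Nat.exists_eq_succ_of_ne_zero hj
    have h := three_add_mul_lucasU 1 j
    rw [sub_self, mul_zero, zero_mul, add_zero] at h
    rw [Nat.succ_eq_add_one, ← h]
    exact mul_ne_zero (by norm_num) (lucasU_one_ne_zero hj)
  · exact (norm_refl_le_transDen hz hz1 j).1

theorem exitGF_transfer (K : ℕ) {z : ℂ} (hz : ‖z‖ < 1 / 3) {j : ℕ} (hj : j ≤ K) :
    (z - 1) * z ^ j * exitGF (K + 1) z 0 (K - j + 1) =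
        exitGF (K + 1) z 2 K * (2 * z * (z + 1) * lucasU z j) ∧
      (z - 1) * z ^ j * exitGF (K + 1) z 2 (K - j) =
        exitGF (K + 1) z 2 K * transDen j z := by
  have hz1 : z - 1 ≠ 0 := by
    intro h
    rw [sub_eq_zero.1 h, norm_one] at hz
    norm_num at hz
  have hz3 : 3 + z ≠ 0 := by
    intro h
    rw [eq_neg_of_add_eq_zero_right h, norm_neg, Complex.norm_ofNat] at hz
    norm_num at hz
  induction j with
  | zero =>
    have h := exitGF_of_not_mem (n := K + 1) (x := K + 1) (by simp) z 0
    simp only [Nat.cast_zero, sub_zero, h, lucasU, transDen]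
    simp [mul_comm]
  | succ j ih =>
    obtain ⟨ihR, ihL⟩ := ih (by omega)
    obtain ⟨hR, hL⟩ := exitGF_scattering (n := K + 1) (x := K - j) (by omega) (by omega) hz
    have e1 : (K : ℤ) - (j + 1 : ℕ) + 1 = K - j := by push_cast; ring
    have e2 : (K : ℤ) - (j + 1 : ℕ) = K - j - 1 := by push_cast; ring
    rw [e1, e2]
    have hd : (z - 1) * z ^ (j + 1) * exitGF (K + 1) z 2 (K - j - 1) =
        exitGF (K + 1) z 2 K * transDen (j + 1) z := by
      refine mul_left_cancel₀ hz1 ?_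
      linear_combination -(z - 1) * z ^ j * hL - 2 * z * (z + 1) * ihR + (3 + z) * ihL -
        exitGF (K + 1) z 2 K * sub_one_mul_transDen_succ z j
    refine ⟨mul_left_cancel₀ hz3 ?_, hd⟩
    linear_combination (z - 1) * z ^ (j + 1) * hR + 2 * z * (z + 1) * hd +
      z ^ 2 * (z - 1) * ihR -
      exitGF (K + 1) z 2 K * (2 * z * (z + 1)) * three_add_mul_lucasU z j

/-- Closed form of the generating function of the left absorption amplitudes. -/
theorem exitGF_mul_transDen (N M : ℕ) {z : ℂ} (hz : ‖z‖ < 1 / 3) :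
    exitGF (N + M + 1) z 0 (M + 1) * transDen (N + M) z =
      2 * z ^ (M + 1) * (z + 1) * lucasU z N := by
  by_cases hz0 : z = 0
  · subst hz0
    have h0 : exitGF (N + M + 1) 0 0 (M + 1) = 0 := by
      rw [exitGF, tsum_eq_single 0 fun t ht => by simp [ht], exitAmp_zero, if_neg (by simp)]
      simp
    simp [h0]
  · have hz1 : z - 1 ≠ 0 := by
      intro h
      rw [sub_eq_zero.1 h, norm_one] at hz
      norm_num at hz
    have hR := (exitGF_transfer (N + M) hz (j := N) (by omega)).1
    have hL := (exitGF_transfer (N + M) hz (j := N + M) le_rfl).2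
    rw [sub_self, exitGF_of_not_mem (by simp), if_pos ⟨rfl, rfl⟩] at hL
    have e : ((N + M : ℕ) : ℤ) - N + 1 = M + 1 := by push_cast; ring
    rw [e] at hR
    push_cast at hR hL
    refine mul_left_cancel₀ (mul_ne_zero hz1 (pow_ne_zero N hz0)) ?_
    rw [pow_add] at hL
    linear_combination transDen (N + M) z * hR - 2 * z * (z + 1) * lucasU z N * hL

/-- The closed form times its reflection, split into a symmetrised sum of two partial fractions. -/
theorem absorption_mul_inv {z : ℂ} (hz0 : z ≠ 0) (hz1 : z ≠ 1) (hv : 3 * z ^ 2 - 2 * z + 3 ≠ 0)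
    {N M : ℕ} (hd : transDen (N + M) z ≠ 0) (hd' : transDen (N + M) z⁻¹ ≠ 0) :
    (2 * z ^ (M + 1) * (z + 1) * lucasU z N / transDen (N + M) z) *
        (2 * z⁻¹ ^ (M + 1) * (z⁻¹ + 1) * lucasU z⁻¹ N / transDen (N + M) z⁻¹) =
      2 * z ^ 2 * (z + 1) ^ 2 * lucasU z N * lucasU z M / transDen (N + M) z / (z - 1) +
        2 * z ^ 2 * (z + 1) * lucasU z N * lucasV z M / transDen (N + M) z /
          (3 * z ^ 2 - 2 * z + 3) +
      (2 * z⁻¹ ^ 2 * (z⁻¹ + 1) ^ 2 * lucasU z⁻¹ N * lucasU z⁻¹ M / transDen (N + M) z⁻¹ /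
          (z⁻¹ - 1) +
        2 * z⁻¹ ^ 2 * (z⁻¹ + 1) * lucasU z⁻¹ N * lucasV z⁻¹ M / transDen (N + M) z⁻¹ /
          (3 * z⁻¹ ^ 2 - 2 * z⁻¹ + 3)) := by
  have hz1' : z - 1 ≠ 0 := sub_ne_zero.2 hz1
  have hP : z ^ N ≠ 0 := pow_ne_zero N hz0
  have hQ : z ^ M ≠ 0 := pow_ne_zero M hz0
  have e1 : lucasU z⁻¹ N = z ^ 2 * lucasU z N / (z ^ N) ^ 2 := by
    rw [← lucasU_inv hz0]; field_simp
  have e2 : lucasU z⁻¹ M = z ^ 2 * lucasU z M / (z ^ M) ^ 2 := by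
    rw [← lucasU_inv hz0]; field_simp
  have e3 : lucasV z⁻¹ M = lucasV z M / (z ^ M) ^ 2 := by
    rw [← lucasV_inv hz0]; field_simp
  have e4 : transDen (N + M) z =
      ((z - 1) * lucasV z (N + M) + (z + 1) * (3 * z ^ 2 - 2 * z + 3) * lucasU z (N + M)) / 2 := by
    rw [← two_mul_transDen]; ring
  have e5 : transDen (N + M) z⁻¹ =
      ((z + 1) * (3 * z ^ 2 - 2 * z + 3) * lucasU z (N + M) - (z - 1) * lucasV z (N + M)) /
        (2 * z * (z ^ N) ^ 2 * (z ^ M) ^ 2) := by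
    have h := two_mul_transDen z⁻¹ (N + M)
    have e6 : lucasU z⁻¹ (N + M) = z ^ 2 * lucasU z (N + M) / (z ^ (N + M)) ^ 2 := by
      rw [← lucasU_inv hz0]; field_simp
    have e7 : lucasV z⁻¹ (N + M) = lucasV z (N + M) / (z ^ (N + M)) ^ 2 := by
      rw [← lucasV_inv hz0]; field_simp
    rw [e6, e7, pow_add] at h
    refine mul_left_cancel₀ (two_ne_zero (α := ℂ)) (h.trans ?_)
    field_simp
    ring
  have e8 : z⁻¹ - 1 = -(z - 1) / z := by field_simp; ring
  have e9 : 3 * z⁻¹ ^ 2 - 2 * z⁻¹ + 3 = (3 * z ^ 2 - 2 * z + 3) / z ^ 2 := by field_simp; ring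
  have e10 : z⁻¹ + 1 = (z + 1) / z := by field_simp; ring
  have key := lucasU_mul_lucasV_sub z N M
  rw [e5] at hd'
  rw [e4] at hd
  rw [e1, e2, e3, e4, e5, e8, e9, e10, inv_pow, inv_pow, pow_succ z M]
  generalize lucasU z N = UN at *
  generalize lucasU z M = UM at *
  generalize lucasV z M = VM at *
  generalize lucasU z (N + M) = UK at *
  generalize lucasV z (N + M) = VK at *
  generalize z ^ N = P at *
  generalize z ^ M = Q at *
  generalize hV : 3 * z ^ 2 - 2 * z + 3 = v at *
  have hd1 := (div_ne_zero_iff.1 hd).1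
  have hd2 := (div_ne_zero_iff.1 hd').1
  clear hd hd' e1 e2 e3 e4 e5 e8 e9 e10 hV
  field_simp
  linear_combination -(2 * (z + 1) ^ 2 * UN * (z - 1) * v) * key

theorem absorption_residue {w : ℂ} (hw : 3 * w ^ 2 - 2 * w + 3 = 0) {N M : ℕ}
    (hN : N ≠ 0) (hd : transDen (N + M) w ≠ 0) {a b : ℂ} (ha : a = -3 + 2 * Real.sqrt 2)
    (hb : b = -3 - 2 * Real.sqrt 2) :
    2 * w ^ 2 * (w + 1) * lucasU w N * lucasV w M / transDen (N + M) w =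
      (a ^ N - b ^ N) * (a ^ M + b ^ M) / ((a - b) * (a ^ (N + M) + b ^ (N + M))) *
        (6 - 2 * w) := by
  have h2 := ofReal_sqrt_sq (x := 2) (by norm_num)
  push_cast at h2
  have hsum : w * a + w * b = -(3 * w ^ 2 + 4 * w + 3) := by
    rw [ha, hb]; linear_combination hw
  have hprod : w * a * (w * b) = w ^ 2 := by
    rw [ha, hb]; linear_combination -4 * w ^ 2 * h2
  have hw0 : w ≠ 0 := by rintro rfl; norm_num at hw
  have hab : a - b ≠ 0 := by
    rw [ha, hb]
    intro h
    have h3 : (Real.sqrt 2 : ℂ) = 0 := by linear_combination h / 4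
    rw [h3] at h2
    norm_num at h2
  have hne : w * a ≠ w * b := fun h => hab (sub_eq_zero.2 (mul_left_cancel₀ hw0 h))
  have hK : a ^ (N + M) + b ^ (N + M) ≠ 0 := by
    rw [ha, hb]
    have := norm_neg_add_lt (a := 3) (b := 2 * Real.sqrt 2) (by norm_num) (by positivity)
    push_cast at this
    exact pow_add_pow_ne_zero_of_norm_lt this (by omega)
  have hU := lucasU_mul_sub hsum hprod N
  have hVM := lucasV_eq hsum hprod hne M
  have hVK := lucasV_eq hsum hprod hne (N + M)
  have hD := two_mul_transDen w (N + M)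
  rw [hw, mul_zero, zero_mul, add_zero, hVK] at hD
  simp only [mul_pow] at hU hVM hD
  rw [div_eq_iff hd, div_mul_eq_mul_div, div_mul_eq_mul_div, eq_div_iff (mul_ne_zero hab hK), hVM]
  rw [pow_add w] at hD
  linear_combination 2 * w * (w + 1) * w ^ M * (a ^ M + b ^ M) * (a ^ (N + M) + b ^ (N + M)) * hU -
    (a ^ N - b ^ N) * (a ^ M + b ^ M) * (3 - w) * hD +
    (a ^ N - b ^ N) * (a ^ M + b ^ M) * (a ^ (N + M) + b ^ (N + M)) * w ^ N * w ^ M * hw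

theorem csqrt_sq {z : ℂ} (hz : 0 < z.re) : csqrt (z ^ 2) = z := by
  have h := Complex.sq_cpow_two_inv hz
  rw [csqrt, one_div]
  exact_mod_cast h

theorem deltaP_one : deltaP 1 = -5 + 2 * Real.sqrt 6 := by
  have h6 := ofReal_sqrt_sq (x := 6) (by norm_num)
  push_cast at h6
  have h : (3 * (1 : ℂ) ^ 2 + 4 * 1 + 3) ^ 2 - 4 * 1 ^ 2 = (4 * Real.sqrt 6) ^ 2 := by
    linear_combination -16 * h6
  rw [deltaP, h, csqrt_sq (by simp)]
  ring

theorem deltaM_one : deltaM 1 = -5 - 2 * Real.sqrt 6 := by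
  have h6 := ofReal_sqrt_sq (x := 6) (by norm_num)
  push_cast at h6
  have h : (3 * (1 : ℂ) ^ 2 + 4 * 1 + 3) ^ 2 - 4 * 1 ^ 2 = (4 * Real.sqrt 6) ^ 2 := by
    linear_combination -16 * h6
  rw [deltaM, h, csqrt_sq (by simp)]
  ring

theorem omg_root : 3 * omg ^ 2 - 2 * omg + 3 = 0 := by
  have h2 := ofReal_sqrt_sq (x := 2) (by norm_num)
  push_cast at h2
  rw [omg]
  linear_combination (4 / 3) * Complex.I ^ 2 * h2 + (8 / 3) * Complex.I_sq

theorem omg_re : omg.re = 1 / 3 := by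
  simp [omg]

theorem omg_disc : (3 * omg ^ 2 + 4 * omg + 3) ^ 2 - 4 * omg ^ 2 =
    (4 * Real.sqrt 2 * omg) ^ 2 := by
  have h2 := ofReal_sqrt_sq (x := 2) (by norm_num)
  push_cast at h2
  linear_combination (3 * omg ^ 2 + 10 * omg + 3) * omg_root - 16 * omg ^ 2 * h2

theorem csqrt_omg_disc : csqrt ((3 * omg ^ 2 + 4 * omg + 3) ^ 2 - 4 * omg ^ 2) =
    4 * Real.sqrt 2 * omg := by
  rw [omg_disc, csqrt_sq]
  have h : (4 * (Real.sqrt 2 : ℂ) * omg).re = 4 * Real.sqrt 2 * omg.re := by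
    rw [show (4 * (Real.sqrt 2 : ℂ) * omg) = ((4 * Real.sqrt 2 : ℝ) : ℂ) * omg by push_cast; ring,
      Complex.re_ofReal_mul]
  rw [h, omg_re]
  positivity

theorem deltaP_omg : deltaP omg = omg * (-3 + 2 * Real.sqrt 2) := by
  rw [deltaP, csqrt_omg_disc]
  linear_combination -(1 / 2) * omg_root

theorem deltaM_omg : deltaM omg = omg * (-3 - 2 * Real.sqrt 2) := by
  rw [deltaM, csqrt_omg_disc]
  linear_combination -(1 / 2) * omg_root

theorem quadratic_inv {z : ℂ} (hz0 : z ≠ 0) :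
    3 * z⁻¹ ^ 2 - 2 * z⁻¹ + 3 = (3 * z ^ 2 - 2 * z + 3) / z ^ 2 := by
  field_simp
  ring

theorem linear_div_add_inv {z : ℂ} (hz0 : z ≠ 0) (hv : 3 * z ^ 2 - 2 * z + 3 ≠ 0) :
    (6 - 2 * z) / (3 * z ^ 2 - 2 * z + 3) +
      (6 - 2 * z⁻¹) / (3 * z⁻¹ ^ 2 - 2 * z⁻¹ + 3) = 2 := by
  rw [quadratic_inv hz0]
  generalize hV : 3 * z ^ 2 - 2 * z + 3 = v at *
  field_simp
  linear_combination 2 * hV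

theorem dslope_one_add_inv (A : ℂ → ℂ) {z : ℂ} (hz0 : z ≠ 0) (hz1 : z ≠ 1) :
    dslope A 1 z + dslope A 1 z⁻¹ = A z / (z - 1) + A z⁻¹ / (z⁻¹ - 1) + A 1 := by
  have h : z - 1 ≠ 0 := sub_ne_zero.2 hz1
  have h' : z⁻¹ ≠ 1 := fun h => hz1 (inv_eq_one.1 h)
  have e : z⁻¹ - 1 = -(z - 1) / z := by field_simp; ring
  rw [dslope_of_ne _ hz1, dslope_of_ne _ h', slope_def_field, slope_def_field, e]
  field_simp
  ring

/-- Removing two zeros of `f` by iterated difference quotients. -/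
theorem dslope_dslope_of_roots {f : ℂ → ℂ} {w w' z : ℂ} (hne : w ≠ w') (hf : f w = 0)
    (hf' : f w' = 0) (hz : z ≠ w) (hz' : z ≠ w') :
    dslope (dslope f w) w' z = f z / ((z - w) * (z - w')) := by
  have h : z - w ≠ 0 := sub_ne_zero.2 hz
  have h' : z - w' ≠ 0 := sub_ne_zero.2 hz'
  rw [dslope_of_ne _ hz', slope_def_field, dslope_of_ne _ hz, dslope_of_ne _ hne.symm,
    slope_def_field, slope_def_field, hf, hf']
  field_simp
  ring

theorem norm_eq_one_of_root {w : ℂ} (hw : w.re = 1 / 3) (hr : 3 * w ^ 2 - 2 * w + 3 = 0) :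
    ‖w‖ = 1 := by
  have h := congrArg Complex.re hr
  simp [pow_two, hw] at h
  have : Complex.normSq w = 1 := by
    rw [Complex.normSq_apply, hw]; linarith
  rw [Complex.norm_def, this, Real.sqrt_one]

/-- The left absorption probability of the finite walk, obtained by writing `G z * G z⁻¹` on the unit
circle as a symmetrisation of a function holomorphic on the closed disc. -/
theorem hasSum_gcFin_sq (N M : ℕ) (hN : N ≠ 0) {a b : ℂ} (ha : a = -3 + 2 * Real.sqrt 2)
    (hb : b = -3 - 2 * Real.sqrt 2) :
    HasSum (fun t => (gcFin (N + M + 1) (M + 1) t : ℂ) ^ 2)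
      (2 * lucasU 1 N * lucasU 1 M / lucasU 1 (N + M) -
        2 * ((a ^ N - b ^ N) * (a ^ M + b ^ M) / ((a - b) * (a ^ (N + M) + b ^ (N + M))))) := by
  have hK : N + M ≠ 0 := by omega
  set s : Set ℂ := {z | transDen (N + M) z ≠ 0}
  have hs : IsOpen s := isOpen_ne_fun (differentiable_transDen (N + M)).continuous continuous_const
  have hmem : ∀ {z : ℂ}, ‖z‖ ≤ 1 → z ∈ s := fun hz => transDen_ne_zero hz hK
  have hsub : Metric.closedBall (0 : ℂ) 1 ⊆ s := fun z hz => hmem (mem_closedBall_zero_iff.1 hz)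
  have dU := differentiable_lucasU
  have dV := differentiable_lucasV
  have dD := differentiable_transDen (N + M)
  set κ := (a ^ N - b ^ N) * (a ^ M + b ^ M) / ((a - b) * (a ^ (N + M) + b ^ (N + M)))
  set G : ℂ → ℂ := fun z => 2 * z ^ (M + 1) * (z + 1) * lucasU z N / transDen (N + M) z with hGd
  set A : ℂ → ℂ := fun z =>
    2 * z ^ 2 * (z + 1) ^ 2 * lucasU z N * lucasU z M / transDen (N + M) z with hAd
  set C : ℂ → ℂ := fun z =>
    2 * z ^ 2 * (z + 1) * lucasU z N * lucasV z M / transDen (N + M) z with hCd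
  have hG : DifferentiableOn ℂ G s := fun z hz =>
    (((by fun_prop : Differentiable ℂ fun z : ℂ => 2 * z ^ (M + 1) * (z + 1)).mul (dU N)) z |>.div
      (dD z) hz).differentiableWithinAt
  have hA : DifferentiableOn ℂ A s := fun z hz =>
    ((((by fun_prop : Differentiable ℂ fun z : ℂ => 2 * z ^ 2 * (z + 1) ^ 2).mul (dU N)).mul
      (dU M)) z |>.div (dD z) hz).differentiableWithinAt
  have hC : DifferentiableOn ℂ C s := fun z hz =>
    ((((by fun_prop : Differentiable ℂ fun z : ℂ => 2 * z ^ 2 * (z + 1)).mul (dU N)).mul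
      (dV M)) z |>.div (dD z) hz).differentiableWithinAt
  set w := omg with hw
  set w' : ℂ := 2 / 3 - omg with hw'
  have hr : 3 * w ^ 2 - 2 * w + 3 = 0 := omg_root
  have hr' : 3 * w' ^ 2 - 2 * w' + 3 = 0 := by rw [hw']; linear_combination hr
  have hre' : w'.re = 1 / 3 := by
    have h := omg_re
    rw [hw', Complex.sub_re, h]; norm_num
  have hn : ‖w‖ = 1 := norm_eq_one_of_root omg_re hr
  have hn' : ‖w'‖ = 1 := norm_eq_one_of_root hre' hr'
  have hfac : ∀ z : ℂ, 3 * z ^ 2 - 2 * z + 3 = 3 * ((z - w) * (z - w')) := by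
    intro z; rw [hw']; linear_combination hr
  have hne : w ≠ w' := by
    intro h
    have h3 : w = 1 / 3 := by rw [hw'] at h; linear_combination h / 2
    rw [h3] at hr; norm_num at hr
  set f : ℂ → ℂ := fun z => C z - κ * (6 - 2 * z) with hfd
  have hfw : f w = 0 := sub_eq_zero.2 (absorption_residue hr hN (hmem hn.le) ha hb)
  have hfw' : f w' = 0 := sub_eq_zero.2 (absorption_residue hr' hN (hmem hn'.le) ha hb)
  have hf : DifferentiableOn ℂ f s := hC.sub (by fun_prop)
  have nhd : ∀ {c : ℂ}, ‖c‖ = 1 → s ∈ 𝓝 c := fun hc => hs.mem_nhds (hmem hc.le)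
  set g : ℂ → ℂ := fun z =>
    dslope A 1 z - A 1 / 2 + (dslope (dslope f w) w' z / 3 + κ) with hgd
  have hg : DifferentiableOn ℂ g s := by
    have h1 := (Complex.differentiableOn_dslope (nhd norm_one)).2 hA
    have h2 := (Complex.differentiableOn_dslope (nhd hn')).2
      ((Complex.differentiableOn_dslope (nhd hn)).2 hf)
    exact (h1.sub_const _).add ((h2.div_const _).add_const _)
  have hid : ∀ z : ℂ, ‖z‖ = 1 → z ∉ ({1, w, w'} : Set ℂ) → G z * G z⁻¹ = g z + g z⁻¹ := by
    intro z hz hzS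
    simp only [Set.mem_insert_iff, Set.mem_singleton_iff, not_or] at hzS
    obtain ⟨hz1, hzw, hzw'⟩ := hzS
    have hz0 : z ≠ 0 := by rintro rfl; simp at hz
    have hzi : ‖z⁻¹‖ = 1 := by rw [norm_inv, hz, inv_one]
    have hv : 3 * z ^ 2 - 2 * z + 3 ≠ 0 := by
      rw [hfac]
      exact mul_ne_zero three_ne_zero (mul_ne_zero (sub_ne_zero.2 hzw) (sub_ne_zero.2 hzw'))
    have hv' : 3 * z⁻¹ ^ 2 - 2 * z⁻¹ + 3 ≠ 0 := by
      rw [quadratic_inv hz0]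
      exact div_ne_zero hv (pow_ne_zero 2 hz0)
    have hD : ∀ x : ℂ, 3 * x ^ 2 - 2 * x + 3 ≠ 0 → dslope (dslope f w) w' x / 3 =
        C x / (3 * x ^ 2 - 2 * x + 3) - κ * (6 - 2 * x) / (3 * x ^ 2 - 2 * x + 3) := by
      intro x hx
      have h1 : x ≠ w := fun h => hx (h ▸ hr)
      have h2 : x ≠ w' := fun h => hx (h ▸ hr')
      rw [dslope_dslope_of_roots hne hfw hfw' h1 h2, div_div, mul_comm _ (3 : ℂ), ← hfac, hfd,
        sub_div]
    have hL : κ * (6 - 2 * z) / (3 * z ^ 2 - 2 * z + 3) +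
        κ * (6 - 2 * z⁻¹) / (3 * z⁻¹ ^ 2 - 2 * z⁻¹ + 3) = 2 * κ := by
      rw [mul_div_assoc, mul_div_assoc, ← mul_add, linear_div_add_inv hz0 hv, mul_comm]
    have h := absorption_mul_inv hz0 hz1 hv (hmem hz.le) (hmem hzi.le)
    refine h.trans ?_
    simp only [hgd]
    rw [hD z hv, hD z⁻¹ hv']
    linear_combination hL - dslope_one_add_inv A hz0 hz1
  have hc : ∀ᶠ z in 𝓝 (0 : ℂ),
      HasSum (fun t => (gcFin (N + M + 1) (M + 1) t : ℂ) * z ^ t) (G z) := by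
    filter_upwards [Metric.ball_mem_nhds (0 : ℂ) (show (0 : ℝ) < 1 / 3 by norm_num)] with z hz
    rw [mem_ball_zero_iff] at hz
    have h := hasSum_exitGF (N + M + 1) hz 0 (M + 1)
    rw [eq_div_of_mul_eq (hmem (by linarith)) (exitGF_mul_transDen N M hz)] at h
    exact_mod_cast h
  have hres := hasSum_sq_of_mul_inv_eq hs hsub hG hg (S := {1, w, w'}) (Set.toFinite _) hid hc
  convert hres using 1
  have hA0 : A 0 = 0 := by simp [hAd]
  have hC0 : C 0 = 0 := by simp [hCd]
  have hA1 : A 1 = 2 * lucasU 1 N * lucasU 1 M / lucasU 1 (N + M) := by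
    have := lucasU_one_ne_zero hK
    have h4 : transDen (N + M) 1 = 4 * lucasU 1 (N + M) := by
      linear_combination two_mul_transDen 1 (N + M) / 2
    simp only [hAd]
    rw [h4]
    field_simp
    ring
  have hw0 : w ≠ 0 := norm_ne_zero_iff.1 (by rw [hn]; exact one_ne_zero)
  have hw0' : w' ≠ 0 := norm_ne_zero_iff.1 (by rw [hn']; exact one_ne_zero)
  have hww : (0 - w) * (0 - w') = 1 := by linear_combination -hfac 0 / 3
  simp only [hgd]
  rw [dslope_dslope_of_roots hne hfw hfw' hw0.symm hw0'.symm, hww, dslope_of_ne _ zero_ne_one,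
    slope_def_field, hA0, ← hA1]
  simp only [hfd]
  rw [hC0]
  ring

theorem finite_absorption_grover (m n : ℕ) (hm : 0 < m) (hmn : m < n) :
    (GPfin n m : ℂ) = (1 / 2) *
      (Fk (n - m) 1 * Fk (m - 1) 1 / ((Real.sqrt 6 : ℂ) * Fk (n - 1) 1) -
       Fk (n - m) omg * Bk (m - 1) omg / ((Real.sqrt 2 : ℂ) * Bk (n - 1) omg)) := by
  obtain ⟨M, rfl⟩ : ∃ M, m = M + 1 := ⟨m - 1, by omega⟩
  obtain ⟨N, rfl⟩ : ∃ N, n = N + M + 1 := ⟨n - M - 1, by omega⟩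
  have hN : N ≠ 0 := by omega
  have e1 : N + M + 1 - (M + 1) = N := by omega
  have h := (hasSum_gcFin_sq N M hN rfl rfl).tsum_eq
  have hP : (GPfin (N + M + 1) (M + 1) : ℂ) = ∑' t, (gcFin (N + M + 1) (M + 1) t : ℂ) ^ 2 := by
    rw [GPfin, Complex.ofReal_tsum]
    simp only [Complex.ofReal_pow]
  have h2 := ofReal_sqrt_sq (x := 2) (by norm_num)
  have h6 := ofReal_sqrt_sq (x := 6) (by norm_num)
  push_cast at h2 h6
  have hs2 : (Real.sqrt 2 : ℂ) ≠ 0 := by intro h; rw [h] at h2; norm_num at h2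
  have hs6 : (Real.sqrt 6 : ℂ) ≠ 0 := by intro h; rw [h] at h6; norm_num at h6
  have hU := lucasU_one_ne_zero (j := N + M) (by omega)
  have hw : omg ≠ 0 := by intro h; have := omg_re; simp [h] at this
  have hwN := pow_ne_zero N hw
  have hwM := pow_ne_zero M hw
  have hK : (-3 + 2 * (Real.sqrt 2 : ℂ)) ^ (N + M) +
      (-3 - 2 * (Real.sqrt 2 : ℂ)) ^ (N + M) ≠ 0 := by
    have := norm_neg_add_lt (a := 3) (b := 2 * Real.sqrt 2) (by norm_num) (by positivity)
    push_cast at this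
    exact pow_add_pow_ne_zero_of_norm_lt this (by omega)
  rw [hP, h, e1, Nat.add_sub_cancel, Nat.add_sub_cancel]
  simp only [Fk, Bk, deltaP_one, deltaM_one, deltaP_omg, deltaM_omg, ← lucasU_one_mul, mul_pow]
  rw [← mul_sub, ← mul_add, ← mul_add]
  generalize (-3 + 2 * (Real.sqrt 2 : ℂ)) ^ (N + M) +
    (-3 - 2 * (Real.sqrt 2 : ℂ)) ^ (N + M) = BK at *
  rw [show -3 + 2 * (Real.sqrt 2 : ℂ) - (-3 - 2 * (Real.sqrt 2 : ℂ)) = 4 * Real.sqrt 2 by ring,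
    pow_add omg]
  field_simp
  ring
end
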